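/- (Chakerian's isoperimetric inequality for polygons) Let P be a convex polygon in a Minkowski plane, let ρI be the largest anticircle contained in P, and let Q be the polygon circumscribed about ρI with sides parallel to those of P. Then area(P) + area(Q) ≤ ρ·L(∂P), where L(∂P) is the perimeter of P in the norm. -/

import Mathlib

/-- The antinorm associated with a norm and a symplectic form `ω`:
`anorm ω x = sup {ω x y : ‖y‖ = 1}`. -/
noncomputable def anorm {V : Type*} [NormedAddCommGroup V] [NormedSpace ℝ V]
    (ω : V →ₗ[ℝ] V →ₗ[ℝ] ℝ) (x : V) : ℝ :=
  sSup {r : ℝ | ∃ y : V, ‖y‖ = 1 ∧ r = ω x y}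

/-- Birkhoff normality: `x ⊣ y` iff `‖x‖ ≤ ‖x + t • y‖` for all `t`. -/
def BNormal {V : Type*} [NormedAddCommGroup V] [NormedSpace ℝ V] (x y : V) : Prop :=
  ∀ t : ℝ, ‖x‖ ≤ ‖x + t • y‖

open MeasureTheory Pointwise

/-- Polygon with unit edge directions `u i` and thresholds `t i`. -/
def chPol {V ι : Type*} [NormedAddCommGroup V] [NormedSpace ℝ V]
    (ω : V →ₗ[ℝ] V →ₗ[ℝ] ℝ) (u : ι → V) (J : Finset ι) (t : ι → ℝ) : Set V :=
  {x | ∀ i ∈ J, ω x (u i) ≤ t i}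

/-- The `i`-th edge. -/
def chEdge {V ι : Type*} [NormedAddCommGroup V] [NormedSpace ℝ V]
    (ω : V →ₗ[ℝ] V →ₗ[ℝ] ℝ) (u : ι → V) (J : Finset ι) (t : ι → ℝ) (i : ι) : Set V :=
  {x | x ∈ chPol ω u J t ∧ ω x (u i) = t i}

/-- Standing assumptions. -/
structure ChSetup {V ι : Type*} [NormedAddCommGroup V] [NormedSpace ℝ V]
    (ω : V →ₗ[ℝ] V →ₗ[ℝ] ℝ) (u v : ι → V) (S : Finset ι) : Prop where
  dim : Module.finrank ℝ V = 2
  alt : ∀ x : V, ω x x = 0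
  nd : ∀ a : V, (∀ y : V, ω a y = 0) → a = 0
  hu : ∀ i ∈ S, ‖u i‖ = 1
  hv1 : ∀ i ∈ S, ω (v i) (u i) = 1
  hv : ∀ i ∈ S, ∀ j ∈ S, ω (v i) (u j) ≤ 1

section chak
variable {V ι : Type*} [NormedAddCommGroup V] [NormedSpace ℝ V]
  {ω : V →ₗ[ℝ] V →ₗ[ℝ] ℝ} {u v : ι → V} {S J : Finset ι} {t : ι → ℝ}

lemma ch_fd (hdim : Module.finrank ℝ V = 2) : FiniteDimensional ℝ V :=
  Module.finite_of_finrank_pos (by omega)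

lemma ch_cont (hdim : Module.finrank ℝ V = 2) (ω : V →ₗ[ℝ] V →ₗ[ℝ] ℝ) (w : V) :
    Continuous (fun x => ω x w) := by
  have := ch_fd hdim
  exact (ω.flip w).continuous_of_finiteDimensional

lemma ch_skew (halt : ∀ x : V, ω x x = 0) (x y : V) : ω x y = - ω y x := by
  have h := halt (x + y)
  simp only [map_add, LinearMap.add_apply, halt] at h
  linarith

lemma ch_ker (hdim : Module.finrank ℝ V = 2) (halt : ∀ x : V, ω x x = 0)
    (hnd : ∀ a : V, (∀ y : V, ω a y = 0) → a = 0) {x w : V} (hw : w ≠ 0) (h : ω x w = 0) :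
    ∃ r : ℝ, x = r • w := by
  by_contra hcon
  push Not at hcon
  have hli : LinearIndependent ℝ ![x, w] := by
    rw [LinearIndependent.pair_iff]
    intro a b hab
    have ha : a = 0 := by
      by_contra ha
      apply hcon (-(a⁻¹ * b))
      have : a⁻¹ • (a • x + b • w) = 0 := by rw [hab, smul_zero]
      rw [smul_add, smul_smul, smul_smul, inv_mul_cancel₀ ha, one_smul] at this
      rw [neg_smul]
      exact eq_neg_of_add_eq_zero_left this
    subst ha
    simp [hw] at hab
    exact ⟨rfl, hab⟩
  have hs := hli.span_eq_top_of_card_eq_finrank (by simp [hdim])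
  apply hw
  apply hnd
  intro y
  have hy : y ∈ Submodule.span ℝ (Set.range ![x, w]) := by rw [hs]; trivial
  rw [Matrix.range_cons, Matrix.range_cons, Matrix.range_empty, Set.union_empty,
    Set.singleton_union, Submodule.mem_span_pair] at hy
  obtain ⟨a, b, rfl⟩ := hy
  simp [halt, ch_skew halt w x, h]

lemma ch_seg (hdim : Module.finrank ℝ V = 2) (halt : ∀ x : V, ω x x = 0)
    (hnd : ∀ a : V, (∀ y : V, ω a y = 0) → a = 0) {w : V} (hw : ‖w‖ = 1) {E : Set V}
    (hc : IsCompact E) (hconv : Convex ℝ E) (hne : E.Nonempty)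
    (h : ∀ x ∈ E, ∀ y ∈ E, ω (x - y) w = 0) :
    ∃ (p : V) (l : ℝ), 0 ≤ l ∧ E = segment ℝ p (p + l • w) := by
  have hw0 : w ≠ 0 := by rintro rfl; simp at hw
  obtain ⟨e, he⟩ := hne
  set g : ℝ → V := fun r => e + r • w with hg
  have hiso : Isometry g := by
    apply Isometry.of_dist_eq
    intro a b
    simp [hg, dist_eq_norm, ← sub_smul, norm_smul, hw]
  have hTc : IsCompact (g ⁻¹' E) := hiso.isClosedEmbedding.isCompact_preimage hc
  have hTconv : Convex ℝ (g ⁻¹' E) := by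
    intro a ha b hb s r hs hr hsr
    have := hconv ha hb hs hr hsr
    simp only [Set.mem_preimage, hg] at *
    convert this using 1
    have : e = (s + r) • e := by rw [hsr, one_smul]
    conv_lhs => rw [this]
    simp only [smul_eq_mul]
    module
  have hTne : (g ⁻¹' E).Nonempty := ⟨0, by simpa [hg] using he⟩
  have hEq := eq_Icc_of_connected_compact ⟨hTne, hTconv.isPreconnected⟩ hTc
  set a := sInf (g ⁻¹' E)
  set b := sSup (g ⁻¹' E)
  have hab : a ≤ b := by
    rw [hEq] at hTne; exact Set.nonempty_Icc.1 hTne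
  have hE : E = g '' (g ⁻¹' E) := by
    rw [Set.image_preimage_eq_of_subset]
    intro x hx
    obtain ⟨r, hr⟩ := ch_ker hdim halt hnd hw0 (h x hx e he)
    exact ⟨r, by simp [hg, ← hr]⟩
  refine ⟨e + a • w, b - a, by linarith, ?_⟩
  rw [hE, hEq]
  have : e + a • w + (b - a) • w = e + b • w := by module
  rw [this, ← segment_eq_Icc hab]
  have := image_segment ℝ (AffineMap.lineMap e (e + w) : ℝ →ᵃ[ℝ] V) a b
  have h2 : ∀ r : ℝ, (AffineMap.lineMap e (e + w) : ℝ →ᵃ[ℝ] V) r = g r := by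
    intro r; simp [AffineMap.lineMap_apply, hg, add_comm]
  rw [← show (AffineMap.lineMap e (e + w) : ℝ →ᵃ[ℝ] V) a = e + a • w from h2 a,
    ← show (AffineMap.lineMap e (e + w) : ℝ →ᵃ[ℝ] V) b = e + b • w from h2 b, ← this]
  exact Set.image_congr (fun r _ => (h2 r).symm)

lemma ch_diam_seg {w : V} (hw : ‖w‖ = 1) {p : V} {l : ℝ} (hl : 0 ≤ l) :
    Metric.diam (segment ℝ p (p + l • w)) = l := by
  rw [← convexHull_pair, convexHull_diam, Metric.diam_pair]
  simp [norm_smul, hw, abs_of_nonneg hl]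

lemma ch_closed (hdim : Module.finrank ℝ V = 2) : IsClosed (chPol ω u J t) := by
  have : chPol ω u J t = ⋂ i ∈ J, {x | ω x (u i) ≤ t i} := by
    ext x; simp [chPol]
  rw [this]
  exact isClosed_biInter fun i _ => isClosed_le (ch_cont hdim ω (u i)) continuous_const

lemma ch_convex : Convex ℝ (chPol ω u J t) := by
  intro x hx y hy a b ha hb hab i hi
  have h1 := mul_le_mul_of_nonneg_left (hx i hi) ha
  have h2 := mul_le_mul_of_nonneg_left (hy i hi) hb
  simp only [map_add, map_smul, LinearMap.add_apply, LinearMap.smul_apply, smul_eq_mul]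
  have : t i = a * t i + b * t i := by rw [← add_mul, hab, one_mul]
  linarith

lemma ch_edge_compact (hdim : Module.finrank ℝ V = 2) (hb : Bornology.IsBounded (chPol ω u J t))
    (i : ι) : IsCompact (chEdge ω u J t i) := by
  have := ch_fd hdim
  have : ProperSpace V := FiniteDimensional.proper ℝ V
  apply Metric.isCompact_of_isClosed_isBounded
  · exact (ch_closed hdim).inter (isClosed_eq (ch_cont hdim ω (u i)) continuous_const)
  · exact hb.subset (fun x hx => hx.1)

lemma ch_edge_convex (i : ι) : Convex ℝ (chEdge ω u J t i) := by
  intro x hx y hy a b ha hb hab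
  refine ⟨ch_convex hx.1 hy.1 ha hb hab, ?_⟩
  simp only [map_add, map_smul, LinearMap.add_apply, LinearMap.smul_apply, smul_eq_mul]
  rw [hx.2, hy.2, ← add_mul, hab, one_mul]

lemma ChSetup.mono (h : ChSetup ω u v S) (hJ : J ⊆ S) : ChSetup ω u v J :=
  ⟨h.dim, h.alt, h.nd, fun i hi => h.hu i (hJ hi), fun i hi => h.hv1 i (hJ hi),
    fun i hi j hj => h.hv i (hJ hi) j (hJ hj)⟩

lemma ch_edge_seg (h : ChSetup ω u v J) (hb : Bornology.IsBounded (chPol ω u J t))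
    {i : ι} (hi : i ∈ J) (hne : (chEdge ω u J t i).Nonempty) :
    ∃ p : V, chEdge ω u J t i =
      segment ℝ p (p + Metric.diam (chEdge ω u J t i) • u i) := by
  obtain ⟨p, l, hl, hE⟩ := ch_seg h.dim h.alt h.nd (h.hu i hi) (ch_edge_compact h.dim hb i)
    (ch_edge_convex i) hne (fun x hx y hy => by
      rw [map_sub, LinearMap.sub_apply, hx.2, hy.2, sub_self])
  refine ⟨p, ?_⟩
  have : Metric.diam (chEdge ω u J t i) = l := by rw [hE, ch_diam_seg (h.hu i hi) hl]
  rw [this, hE]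

/-- Superadditivity of edge lengths. -/
lemma ch_edge_add {K : Finset ι} {t₁ t₂ t₃ : ι → ℝ} {δ : ℝ} (h : ChSetup ω u v J)
    (h' : ChSetup ω u v K)
    (hb₁ : Bornology.IsBounded (chPol ω u J t₁)) (hb₂ : Bornology.IsBounded (chPol ω u K t₂))
    (hb₃ : Bornology.IsBounded (chPol ω u J t₃))
    {i : ι} (hi : i ∈ J) (hi' : i ∈ K) (hn₁ : (chEdge ω u J t₁ i).Nonempty)
    (hn₂ : (chEdge ω u K t₂ i).Nonempty)
    (hsub : ∀ x ∈ chEdge ω u J t₁ i, ∀ y ∈ chEdge ω u K t₂ i, x + δ • y ∈ chEdge ω u J t₃ i) :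
    Metric.diam (chEdge ω u J t₁ i) + δ * Metric.diam (chEdge ω u K t₂ i) ≤
      Metric.diam (chEdge ω u J t₃ i) := by
  obtain ⟨p, hp⟩ := ch_edge_seg h hb₁ hi hn₁
  obtain ⟨q, hq⟩ := ch_edge_seg h' hb₂ hi' hn₂
  set a := Metric.diam (chEdge ω u J t₁ i)
  set b := Metric.diam (chEdge ω u K t₂ i)
  have m1 := hsub p (by rw [hp]; exact left_mem_segment _ _ _) q
    (by rw [hq]; exact left_mem_segment _ _ _)
  have m2 := hsub (p + a • u i) (by rw [hp]; exact right_mem_segment _ _ _) (q + b • u i)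
    (by rw [hq]; exact right_mem_segment _ _ _)
  have := Metric.dist_le_diam_of_mem (hb₃.subset (fun x hx => hx.1)) m2 m1
  have e : p + a • u i + δ • (q + b • u i) - (p + δ • q) = (a + δ * b) • u i := by module
  rw [dist_eq_norm, e, norm_smul, h.hu i hi, mul_one] at this
  exact (le_abs_self _).trans this

variable [MeasurableSpace V] [BorelSpace V]

lemma ch_edge_hausdorff (h : ChSetup ω u v J) (hb : Bornology.IsBounded (chPol ω u J t))
    {i : ι} (hi : i ∈ J) :
    μH[1] (chEdge ω u J t i) = ENNReal.ofReal (Metric.diam (chEdge ω u J t i)) := by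
  rcases (chEdge ω u J t i).eq_empty_or_nonempty with he | hne
  · simp [he]
  · obtain ⟨p, hp⟩ := ch_edge_seg h hb hi hne
    have : μH[1] (segment ℝ p (p + Metric.diam (chEdge ω u J t i) • u i)) =
      ENNReal.ofReal (Metric.diam (chEdge ω u J t i)) := by
      rw [hausdorffMeasure_segment, edist_dist]
      simp [norm_smul, h.hu i hi, abs_of_nonneg Metric.diam_nonneg]
    rw [← this, ← hp]

/-- The layer over an edge has area at most `s * length`. -/
lemma ch_layer (h : ChSetup ω u v J) (μ : Measure V) [μ.IsAddHaarMeasure]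
    (hμω : ∀ x y : V,
      μ (Set.image2 (fun s t : ℝ => s • x + t • y) (Set.Icc 0 1) (Set.Icc 0 1)) =
        ENNReal.ofReal |ω x y|)
    (hb : Bornology.IsBounded (chPol ω u J t)) {i : ι} (hi : i ∈ J) {s : ℝ} (hs : 0 < s) :
    ∃ T : Set V, (∀ x r, 0 ≤ r → r ≤ s → x + r • v i ∈ chEdge ω u J t i → x ∈ T) ∧
      μ T ≤ ENNReal.ofReal (s * Metric.diam (chEdge ω u J t i)) := by
  rcases (chEdge ω u J t i).eq_empty_or_nonempty with he | hne
  · refine ⟨∅, ?_, by simp⟩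
    intro x r _ _ hx
    simp [he] at hx
  · obtain ⟨p, hp⟩ := ch_edge_seg h hb hi hne
    set l := Metric.diam (chEdge ω u J t i) with hl
    have hl0 : 0 ≤ l := Metric.diam_nonneg
    refine ⟨(fun x => p + x) '' (Set.image2 (fun a b : ℝ => a • (l • u i) + b • (-s • v i))
      (Set.Icc 0 1) (Set.Icc 0 1)), ?_, ?_⟩
    · intro x r hr hrs hx
      rw [hp, segment_eq_image'] at hx
      obtain ⟨θ, hθ, hx⟩ := hx
      refine ⟨_, ⟨θ, hθ, r / s, ⟨by positivity, by rw [div_le_one hs]; exact hrs⟩, rfl⟩, ?_⟩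
      simp only [add_sub_cancel_left] at hx
      have e : (r / s) • (-s • v i) = -(r • v i) := by
        rw [smul_smul, ← neg_smul]; congr 1; field_simp
      simp only [e]
      rw [← add_assoc, hx]; abel
    · rw [Set.image_add_left, measure_preimage_add, hμω]
      apply ENNReal.ofReal_le_ofReal
      simp only [map_smul, LinearMap.smul_apply, smul_eq_mul]
      rw [ch_skew h.alt, h.hv1 i hi]
      rw [show -s * (l * -1) = s * l by ring, abs_of_nonneg (by positivity)]

/-- Covering inequality. -/
lemma ch_cover (h : ChSetup ω u v J) (μ : Measure V) [μ.IsAddHaarMeasure]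
    (hμω : ∀ x y : V,
      μ (Set.image2 (fun s t : ℝ => s • x + t • y) (Set.Icc 0 1) (Set.Icc 0 1)) =
        ENNReal.ofReal |ω x y|)
    (hb : Bornology.IsBounded (chPol ω u J t)) {s : ℝ} (hs : 0 < s) :
    (μ (chPol ω u J t)).toReal ≤ (μ (chPol ω u J (fun i => t i - s))).toReal +
      s * ∑ i ∈ J, Metric.diam (chEdge ω u J t i) := by
  have hL : ∀ i : ι, ∃ T : Set V, i ∈ J →
      ((∀ x r, 0 ≤ r → r ≤ s → x + r • v i ∈ chEdge ω u J t i → x ∈ T) ∧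
      μ T ≤ ENNReal.ofReal (s * Metric.diam (chEdge ω u J t i))) := by
    intro i
    by_cases hi : i ∈ J
    · obtain ⟨T, hT⟩ := ch_layer h μ hμω hb hi hs
      exact ⟨T, fun _ => hT⟩
    · exact ⟨∅, fun h => absurd h hi⟩
  choose T hT using hL
  have hsub : chPol ω u J t ⊆ chPol ω u J (fun i => t i - s) ∪ ⋃ i ∈ J, T i := by
    intro x hx
    by_cases hx' : x ∈ chPol ω u J (fun i => t i - s)
    · exact Or.inl hx'
    · right
      simp only [chPol, Set.mem_ofPred_eq, not_forall, not_le] at hx'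
      obtain ⟨j, hj, hjs⟩ := hx'
      obtain ⟨i, hi, hmin⟩ := Finset.exists_min_image J (fun i => t i - ω x (u i)) ⟨j, hj⟩
      have hσ0 : 0 ≤ t i - ω x (u i) := sub_nonneg.2 (hx i hi)
      refine Set.mem_biUnion hi ((hT i hi).1 x (t i - ω x (u i)) hσ0 ?_ ⟨?_, ?_⟩)
      · have := hmin j hj; linarith
      · intro k hk
        have h1 := hmin k hk
        have h2 := mul_le_mul_of_nonneg_left (h.hv i hi k hk) hσ0
        simp only [map_add, map_smul, LinearMap.add_apply, LinearMap.smul_apply, smul_eq_mul]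
        linarith
      · simp only [map_add, map_smul, LinearMap.add_apply, LinearMap.smul_apply, smul_eq_mul]
        rw [h.hv1 i hi]; ring
  have hfin : μ (chPol ω u J (fun i => t i - s)) ≠ ⊤ := by
    have := ch_fd h.dim
    have : ProperSpace V := FiniteDimensional.proper ℝ V
    refine (hb.subset ?_).measure_lt_top.ne
    intro x hx i hi
    have := hx i hi
    simp only at this
    linarith
  have h1 : μ (chPol ω u J t) ≤ μ (chPol ω u J (fun i => t i - s)) +
      ∑ i ∈ J, ENNReal.ofReal (s * Metric.diam (chEdge ω u J t i)) := by
    refine (measure_mono hsub).trans ((measure_union_le _ _).trans ?_)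
    gcongr
    exact (measure_biUnion_finset_le _ _).trans (Finset.sum_le_sum fun i hi => (hT i hi).2)
  have hnn : ∀ i ∈ J, 0 ≤ s * Metric.diam (chEdge ω u J t i) :=
    fun i _ => mul_nonneg hs.le Metric.diam_nonneg
  rw [← ENNReal.ofReal_sum_of_nonneg hnn] at h1
  have := ENNReal.toReal_mono (ENNReal.add_ne_top.2 ⟨hfin, ENNReal.ofReal_ne_top⟩) h1
  rwa [ENNReal.toReal_add hfin ENNReal.ofReal_ne_top,
    ENNReal.toReal_ofReal (Finset.sum_nonneg hnn), ← Finset.mul_sum] at this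

lemma ch_anti {J K : Finset ι} (hJ : J ⊆ K) {t t' : ι → ℝ} (h : ∀ i, t' i ≤ t i) :
    chPol ω u K t' ⊆ chPol ω u J t :=
  fun _ hx i hi => (hx i (hJ hi)).trans (h i)

lemma ch_bdd_meas (hdim : Module.finrank ℝ V = 2) (μ : Measure V) [μ.IsAddHaarMeasure]
    {K : Set V} (hb : Bornology.IsBounded K) : μ K ≠ ⊤ := by
  have := ch_fd hdim
  have : ProperSpace V := FiniteDimensional.proper ℝ V
  exact hb.measure_lt_top.ne

open Classical in
lemma ch_active (hne : (chPol ω u S t).Nonempty) :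
    chPol ω u (S.filter fun i => (chEdge ω u S t i).Nonempty) t = chPol ω u S t := by
  apply Set.Subset.antisymm _ (ch_anti (Finset.filter_subset _ _) fun _ => le_rfl)
  intro x hx
  obtain ⟨y, hy⟩ := hne
  by_contra hcon
  obtain ⟨j₀, hj₀, hj₀x⟩ : ∃ j ∈ S, t j < ω x (u j) := by
    by_contra hc
    push Not at hc
    exact hcon hc
  set B := S.filter fun j => t j < ω x (u j) with hB
  obtain ⟨j, hj, hmin⟩ := Finset.exists_min_image B
    (fun j => (t j - ω y (u j)) / (ω x (u j) - ω y (u j)))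
    ⟨j₀, Finset.mem_filter.2 ⟨hj₀, hj₀x⟩⟩
  obtain ⟨hjS, hjx⟩ := Finset.mem_filter.1 hj
  set r := (t j - ω y (u j)) / (ω x (u j) - ω y (u j)) with hr
  have hjy := hy j hjS
  have hpos : 0 < ω x (u j) - ω y (u j) := by linarith
  have hr0 : 0 ≤ r := div_nonneg (by linarith) hpos.le
  have hr1 : r ≤ 1 := by rw [hr, div_le_one hpos]; linarith
  have hval : ∀ k, ω (y + r • (x - y)) (u k) = ω y (u k) + r * (ω x (u k) - ω y (u k)) := by
    intro k; simp
  have hedge : y + r • (x - y) ∈ chEdge ω u S t j := by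
    refine ⟨?_, ?_⟩
    · intro k hk
      rw [hval]
      have hky := hy k hk
      by_cases hkB : t k < ω x (u k)
      · have h1 := hmin k (Finset.mem_filter.2 ⟨hk, hkB⟩)
        have hp : 0 < ω x (u k) - ω y (u k) := by linarith
        rw [le_div_iff₀ hp] at h1
        linarith
      · push Not at hkB
        nlinarith
    · rw [hval, hr, div_mul_cancel₀ _ hpos.ne']; ring
  have := hx j (Finset.mem_filter.2 ⟨hjS, ⟨_, hedge⟩⟩)
  linarith

lemma ch_two_area (h : ChSetup ω u v J) (μ : Measure V) [μ.IsAddHaarMeasure]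
    (hμω : ∀ x y : V,
      μ (Set.image2 (fun s t : ℝ => s • x + t • y) (Set.Icc 0 1) (Set.Icc 0 1)) =
        ENNReal.ofReal |ω x y|)
    (hb : Bornology.IsBounded (chPol ω u J (fun _ => 1))) :
    2 * (μ (chPol ω u J (fun _ => 1))).toReal ≤
      ∑ i ∈ J, Metric.diam (chEdge ω u J (fun _ => 1) i) := by
  set A := (μ (chPol ω u J (fun _ => 1))).toReal with hA
  set L := ∑ i ∈ J, Metric.diam (chEdge ω u J (fun _ => 1) i) with hL
  have hL0 : 0 ≤ L := Finset.sum_nonneg fun _ _ => Metric.diam_nonneg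
  have key : ∀ s : ℝ, 0 < s → s < 1 → A ≤ (1 - s) ^ 2 * A + s * L := by
    intro s hs hs1
    have h1 := ch_cover h μ hμω hb hs
    have h2 : chPol ω u J (fun _ => 1 - s) = (1 - s) • chPol ω u J (fun _ => (1 : ℝ)) := by
      have hs' : 0 < 1 - s := by linarith
      ext x
      rw [Set.mem_smul_set_iff_inv_smul_mem₀ hs'.ne']
      simp only [chPol, Set.mem_ofPred_eq, map_smul, LinearMap.smul_apply, smul_eq_mul]
      refine forall₂_congr fun i _ => ?_
      rw [inv_mul_le_iff₀ hs', mul_one]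
    have := ch_fd h.dim
    rw [h2, Measure.addHaar_smul, h.dim, ENNReal.toReal_mul,
      ENNReal.toReal_ofReal (abs_nonneg _), abs_of_nonneg (sq_nonneg _)] at h1
    exact h1
  by_contra hcon
  push Not at hcon
  have hApos : 0 < A := by linarith
  have hs0 : 0 < (2 * A - L) / (4 * A) := div_pos (by linarith) (by linarith)
  have hs1 : (2 * A - L) / (4 * A) < 1 := by rw [div_lt_one (by linarith)]; linarith
  have hk := key _ hs0 hs1
  have hsA : (2 * A - L) / (4 * A) * A = (2 * A - L) / 4 := by field_simp
  set s := (2 * A - L) / (4 * A)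
  have : s * (2 * A - s * A - L) ≤ 0 := by nlinarith
  have h3 : 0 < s * (2 * A - s * A - L) := mul_pos hs0 (by linarith)
  linarith

open Classical in
lemma ch_step (h : ChSetup ω u v S) (μ : Measure V) [μ.IsAddHaarMeasure]
    (hμω : ∀ x y : V,
      μ (Set.image2 (fun s t : ℝ => s • x + t • y) (Set.Icc 0 1) (Set.Icc 0 1)) =
        ENNReal.ofReal |ω x y|)
    (hb : Bornology.IsBounded (chPol ω u S t)) {δ : ℝ} (hδ : 0 < δ)
    {t' : ι → ℝ} (ht' : ∀ i, t' i = t i - δ)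
    (hne : (chPol ω u S t').Nonempty) :
    ∑ i ∈ S, Metric.diam (chEdge ω u S t' i) +
      2 * δ * (μ (chPol ω u S (fun _ => 1))).toReal *
        (1 - (((S.filter fun i => (chEdge ω u S t i).Nonempty).card : ℝ) -
          ((S.filter fun i => (chEdge ω u S t' i).Nonempty).card : ℝ)))
      ≤ ∑ i ∈ S, Metric.diam (chEdge ω u S t i) := by
  have hb' : Bornology.IsBounded (chPol ω u S t') :=
    hb.subset (ch_anti (subset_refl _) fun i => by rw [ht']; linarith)
  have hshift : ∀ i ∈ S, ∀ x ∈ chEdge ω u S t' i, x + δ • v i ∈ chEdge ω u S t i := by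
    intro i hi x hx
    refine ⟨fun k hk => ?_, ?_⟩
    · have h1 := hx.1 k hk
      have h2 := mul_le_mul_of_nonneg_left (h.hv i hi k hk) hδ.le
      rw [ht'] at h1
      simp only [map_add, map_smul, LinearMap.add_apply, LinearMap.smul_apply, smul_eq_mul]
      linarith
    · simp only [map_add, map_smul, LinearMap.add_apply, LinearMap.smul_apply, smul_eq_mul]
      rw [h.hv1 i hi, hx.2, ht']; ring
  have hmono : ∀ i ∈ S, Metric.diam (chEdge ω u S t' i) ≤ Metric.diam (chEdge ω u S t i) := by
    intro i hi
    apply Metric.diam_le_of_forall_dist_le Metric.diam_nonneg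
    intro x hx y hy
    have := Metric.dist_le_diam_of_mem (hb.subset (fun x hx => hx.1)) (hshift i hi x hx)
      (hshift i hi y hy)
    simpa using this
  set J := S.filter fun i => (chEdge ω u S t i).Nonempty with hJ
  set J' := S.filter fun i => (chEdge ω u S t' i).Nonempty with hJ'
  set A := (μ (chPol ω u S (fun _ => 1))).toReal with hA
  have hA0 : 0 ≤ A := ENNReal.toReal_nonneg
  have hJJ : J' ⊆ J := by
    intro i hi
    obtain ⟨hi, x, hx⟩ := Finset.mem_filter.1 hi
    exact Finset.mem_filter.2 ⟨hi, _, hshift i hi x hx⟩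
  rcases hJJ.eq_or_ssubset with heq | hss
  · have hneS : (chPol ω u S t).Nonempty :=
      hne.mono (ch_anti (subset_refl _) fun i => by rw [ht']; linarith)
    have e1 : chPol ω u J t = chPol ω u S t := ch_active hneS
    have e2 : chPol ω u J t' = chPol ω u S t' := by rw [← heq]; exact ch_active hne
    have ee1 : ∀ i, chEdge ω u J t i = chEdge ω u S t i := by
      intro i; simp only [chEdge, e1]
    have ee2 : ∀ i, chEdge ω u J t' i = chEdge ω u S t' i := by
      intro i; simp only [chEdge, e2]
    have hJS : J ⊆ S := Finset.filter_subset _ _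
    have hJset := h.mono hJS
    have hsum : ∀ x ∈ chPol ω u J t', ∀ y ∈ chPol ω u J (fun _ => (1 : ℝ)),
        x + δ • y ∈ chPol ω u J t := by
      intro x hx y hy k hk
      have h1 := hx k hk
      have h2 := mul_le_mul_of_nonneg_left (hy k hk) hδ.le
      rw [ht'] at h1
      simp only [map_add, map_smul, LinearMap.add_apply, LinearMap.smul_apply, smul_eq_mul]
      linarith
    have hbQ : Bornology.IsBounded (chPol ω u J (fun _ => (1 : ℝ))) := by
      obtain ⟨x, hx⟩ := hne
      rw [← e2] at hx
      rw [← e1] at hb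
      obtain ⟨C, hC⟩ := hb.exists_norm_le
      rw [isBounded_iff_forall_norm_le]
      refine ⟨δ⁻¹ * (C + ‖x‖), fun y hy => ?_⟩
      have h1 := hC _ (hsum x hx y hy)
      have h2 : ‖δ • y‖ ≤ C + ‖x‖ := by
        have : δ • y = (x + δ • y) - x := by abel
        rw [this]
        exact (norm_sub_le _ _).trans (by linarith)
      rw [norm_smul, Real.norm_of_nonneg hδ.le] at h2
      rw [le_inv_mul_iff₀ hδ]
      exact h2
    have hQA : A ≤ (μ (chPol ω u J (fun _ => 1))).toReal :=
      ENNReal.toReal_mono (ch_bdd_meas h.dim μ hbQ)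
        (measure_mono (ch_anti hJS fun _ => le_rfl))
    have h2A := ch_two_area hJset μ hμω hbQ
    have hper : ∀ i ∈ J, Metric.diam (chEdge ω u S t' i) +
        δ * Metric.diam (chEdge ω u J (fun _ => 1) i) ≤ Metric.diam (chEdge ω u S t i) := by
      intro i hi
      rw [← ee1, ← ee2]
      apply ch_edge_add hJset hJset (by rwa [e2]) hbQ (by rwa [e1]) hi hi
      · rw [ee2]
        rw [← heq] at hi
        exact (Finset.mem_filter.1 hi).2
      · exact ⟨v i, fun k hk => hJset.hv i hi k hk, hJset.hv1 i hi⟩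
      · intro x hx y hy
        refine ⟨hsum x hx.1 y hy.1, ?_⟩
        simp only [map_add, map_smul, LinearMap.add_apply, LinearMap.smul_apply, smul_eq_mul]
        rw [hx.2, hy.2, ht']; ring
    have s1 : ∑ i ∈ S, Metric.diam (chEdge ω u S t i)
        = ∑ i ∈ J, Metric.diam (chEdge ω u S t i) := by
      symm
      apply Finset.sum_subset hJS
      intro i hi hiJ
      have : chEdge ω u S t i = ∅ := by
        by_contra hc
        exact hiJ (Finset.mem_filter.2 ⟨hi, Set.nonempty_iff_ne_empty.2 hc⟩)
      simp [this]
    have s2 : ∑ i ∈ S, Metric.diam (chEdge ω u S t' i)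
        = ∑ i ∈ J, Metric.diam (chEdge ω u S t' i) := by
      symm
      apply Finset.sum_subset hJS
      intro i hi hiJ
      have : chEdge ω u S t' i = ∅ := by
        by_contra hc
        rw [← heq] at hiJ
        exact hiJ (Finset.mem_filter.2 ⟨hi, Set.nonempty_iff_ne_empty.2 hc⟩)
      simp [this]
    have := Finset.sum_le_sum hper
    rw [Finset.sum_add_distrib, ← Finset.mul_sum] at this
    rw [s1, s2, heq, sub_self, sub_zero, mul_one]
    have h5 := mul_le_mul_of_nonneg_left (hQA) hδ.le
    have h6 := mul_le_mul_of_nonneg_left h2A hδ.le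
    linarith
  · have hc : (J'.card : ℝ) + 1 ≤ J.card := by exact_mod_cast Finset.card_lt_card hss
    have h1 := Finset.sum_le_sum hmono
    have h2 : 2 * δ * A * (1 - ((J.card : ℝ) - J'.card)) ≤ 0 :=
      mul_nonpos_of_nonneg_of_nonpos (by positivity) (by linarith)
    linarith

open Classical in
lemma ch_main (h : ChSetup ω u v S) (μ : Measure V) [μ.IsAddHaarMeasure]
    (hμω : ∀ x y : V,
      μ (Set.image2 (fun s t : ℝ => s • x + t • y) (Set.Icc 0 1) (Set.Icc 0 1)) =
        ENNReal.ofReal |ω x y|)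
    (hb : Bornology.IsBounded (chPol ω u S t)) {ρ : ℝ} (hρ : 0 < ρ)
    (hne : (chPol ω u S (fun i => t i - ρ)).Nonempty)
    (hzero : μ (chPol ω u S (fun i => t i - ρ)) = 0) :
    (μ (chPol ω u S t)).toReal + ρ ^ 2 * (μ (chPol ω u S (fun _ => 1))).toReal ≤
      ρ * ∑ i ∈ S, Metric.diam (chEdge ω u S t i) := by
  set A := (μ (chPol ω u S (fun _ => 1))).toReal with hA
  set L := ∑ i ∈ S, Metric.diam (chEdge ω u S t i) with hL
  have hA0 : 0 ≤ A := ENNReal.toReal_nonneg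
  set n : ℝ := (S.card : ℝ) with hn
  have key : ∀ N : ℕ, 0 < N → (μ (chPol ω u S t)).toReal ≤
      ρ * L - ρ ^ 2 * A + ρ ^ 2 * A * (1 + 2 * n) / N := by
    intro N hN
    have hN' : (0 : ℝ) < N := by exact_mod_cast hN
    set δ := ρ / N with hδ
    have hδ0 : 0 < δ := by positivity
    have hδN : N * δ = ρ := by rw [hδ]; field_simp
    let τ : ℕ → ι → ℝ := fun k i => t i - k * δ
    have hτ0 : τ 0 = t := by funext i; simp [τ]
    have hτN : τ N = fun i => t i - ρ := by funext i; simp [τ, hδN]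
    have hτs : ∀ k i, τ (k + 1) i = τ k i - δ := by
      intro k i; simp only [τ]; push_cast; ring
    have hτb : ∀ k, Bornology.IsBounded (chPol ω u S (τ k)) := by
      intro k
      refine hb.subset (ch_anti (subset_refl _) fun i => ?_)
      have : (0 : ℝ) ≤ k * δ := by positivity
      simp only [τ]; linarith
    have hτne : ∀ k, k ≤ N → (chPol ω u S (τ k)).Nonempty := by
      intro k hk
      refine hne.mono (ch_anti (subset_refl _) fun i => ?_)
      have : (k : ℝ) * δ ≤ N * δ := by gcongr
      simp only [τ]; linarith
    let c : ℕ → ℝ := fun k => ((S.filter fun i => (chEdge ω u S (τ k) i).Nonempty).card : ℝ)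
    have hc0 : ∀ k, 0 ≤ c k := fun k => Nat.cast_nonneg _
    have hcn : ∀ k, c k ≤ n := fun k => by
      simp only [c, hn]; exact_mod_cast Finset.card_filter_le _ _
    let Lk : ℕ → ℝ := fun k => ∑ i ∈ S, Metric.diam (chEdge ω u S (τ k) i)
    have hLk : ∀ k, k ≤ N → Lk k ≤ L - 2 * δ * A * (k - c 0 + c k) := by
      intro k
      induction k with
      | zero => intro _; simp [Lk, hτ0, hL]
      | succ k ih =>
        intro hk
        have h1 := ih (by omega)
        have h2 : Lk (k + 1) + 2 * δ * A * (1 - (c k - c (k + 1))) ≤ Lk k :=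
          ch_step h μ hμω (hτb k) hδ0 (hτs k) (hτne (k + 1) hk)
        push_cast
        linarith
    have hLk' : ∀ k, k ≤ N → Lk k ≤ L - 2 * δ * A * (k - n) := by
      intro k hk
      have h1 := hLk k hk
      have h2 : 2 * δ * A * (k - n) ≤ 2 * δ * A * (k - c 0 + c k) := by
        apply mul_le_mul_of_nonneg_left _ (by positivity)
        have := hc0 k; have := hcn 0; linarith
      linarith
    have hAk : ∀ k, k ≤ N → (μ (chPol ω u S t)).toReal ≤ (μ (chPol ω u S (τ k))).toReal +
        k * δ * L - δ ^ 2 * A * (k * (k - 1)) + 2 * δ ^ 2 * A * n * k := by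
      intro k
      induction k with
      | zero => intro _; simp [hτ0]
      | succ k ih =>
        intro hk
        have h1 := ih (by omega)
        have h2 : (μ (chPol ω u S (τ k))).toReal ≤ (μ (chPol ω u S (τ (k + 1)))).toReal +
            δ * Lk k := by
          have e : τ (k + 1) = fun i => τ k i - δ := funext (hτs k)
          rw [e]
          exact ch_cover h μ hμω (hτb k) hδ0
        have h3 := mul_le_mul_of_nonneg_left (hLk' k (by omega)) hδ0.le
        push_cast
        linarith
    have := hAk N le_rfl
    rw [hτN, hzero, ENNReal.toReal_zero] at this
    have e : δ = ρ / N := hδ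
    rw [e] at this
    refine this.trans (le_of_eq ?_)
    field_simp
    ring
  have hlim : Filter.Tendsto (fun N : ℕ => ρ * L - ρ ^ 2 * A + ρ ^ 2 * A * (1 + 2 * n) / (N : ℝ))
      Filter.atTop (nhds (ρ * L - ρ ^ 2 * A + 0)) :=
    tendsto_const_nhds.add (tendsto_const_div_atTop_nhds_zero_nat _)
  have := ge_of_tendsto hlim (Filter.eventually_atTop.2 ⟨1, fun N hN => key N hN⟩)
  linarith

lemma ch_interior {K : Set V} {x : V} (hx : x ∈ interior K) (w : V) :
    ∀ᶠ ε : ℝ in nhdsWithin 0 (Set.Ioi 0), x + ε • w ∈ K := by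
  have hc : ContinuousAt (fun ε : ℝ => x + ε • w) 0 := by fun_prop
  have : K ∈ nhds (x + (0 : ℝ) • w) := by
    rw [zero_smul, add_zero]; exact mem_interior_iff_mem_nhds.1 hx
  exact (hc.eventually_mem this).filter_mono nhdsWithin_le_nhds

lemma ch_surj (hdim : Module.finrank ℝ V = 2)
    (hnd : ∀ a : V, (∀ y : V, ω a y = 0) → a = 0) (g : V →ₗ[ℝ] ℝ) :
    ∃ w : V, ∀ x, g x = ω w x := by
  have := ch_fd hdim
  have hinj : Function.Injective ω := by
    rw [injective_iff_map_eq_zero]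
    intro a ha
    exact hnd a fun y => by rw [ha]; rfl
  have hs := (LinearMap.injective_iff_surjective_of_finrank_eq_finrank
    (f := (ω : V →ₗ[ℝ] Module.Dual ℝ V)) (Subspace.dual_finrank_eq).symm).1 hinj
  obtain ⟨w, hw⟩ := hs g
  exact ⟨w, fun x => by rw [hw]⟩

lemma ch_dual (hdim : Module.finrank ℝ V = 2)
    (hnd : ∀ a : V, (∀ y : V, ω a y = 0) → a = 0) {w : V} (hw : ‖w‖ = 1) :
    ∃ z : V, ω z w = 1 ∧ ∀ y, ω z y ≤ ‖y‖ := by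
  obtain ⟨g, hg, hgw⟩ := exists_dual_vector ℝ w (by rw [hw]; norm_num)
  obtain ⟨z, hz⟩ := ch_surj (ω := ω) hdim hnd (g : V →ₗ[ℝ] ℝ)
  refine ⟨z, ?_, fun y => ?_⟩
  · rw [← hz]; simp [hgw, hw]
  · rw [← hz]
    have := g.le_opNorm y
    rw [hg, one_mul] at this
    exact (le_abs_self _).trans this

lemma ch_anorm (hdim : Module.finrank ℝ V = 2) (x : V) (r : ℝ) :
    anorm ω x ≤ r ↔ ∀ y : V, ‖y‖ = 1 → ω x y ≤ r := by
  have := ch_fd hdim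
  have : Nontrivial V := Module.nontrivial_of_finrank_pos (R := ℝ) (by omega)
  obtain ⟨y₀, hy₀⟩ := exists_norm_eq V (zero_le_one' ℝ)
  have hmem : ∀ y : V, ‖y‖ = 1 → ω x y ∈ {r : ℝ | ∃ y : V, ‖y‖ = 1 ∧ r = ω x y} :=
    fun y hy => ⟨y, hy, rfl⟩
  unfold anorm
  constructor
  · intro h y hy
    refine le_trans (le_csSup ?_ (hmem y hy)) h
    refine ⟨‖(ω x).toContinuousLinearMap‖, ?_⟩
    rintro _ ⟨z, hz, rfl⟩
    have := (ω x).toContinuousLinearMap.le_opNorm z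
    rw [hz, mul_one] at this
    exact (le_abs_self _).trans this
  · intro h
    apply csSup_le ⟨_, hmem y₀ hy₀⟩
    rintro _ ⟨z, hz, rfl⟩
    exact h z hz

lemma ch_edge_frontier (h : ChSetup ω u v S) {i : ι} (hi : i ∈ S) :
    chEdge ω u S t i ⊆ frontier (chPol ω u S t) := by
  intro x hx
  rw [(ch_closed h.dim).frontier_eq]
  refine ⟨hx.1, fun hinter => ?_⟩
  obtain ⟨ε, hε, hε0⟩ := ((ch_interior hinter (v i)).and self_mem_nhdsWithin).exists
  have h1 := hε i hi
  simp only [map_add, map_smul, LinearMap.add_apply, LinearMap.smul_apply, smul_eq_mul,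
    h.hv1 i hi, hx.2] at h1
  have : (0 : ℝ) < ε := hε0
  linarith

lemma ch_frontier_sub (hdim : Module.finrank ℝ V = 2) :
    frontier (chPol ω u S t) ⊆ ⋃ i ∈ S, chEdge ω u S t i := by
  intro x hx
  rw [(ch_closed hdim).frontier_eq] at hx
  by_contra hcon
  simp only [Set.mem_iUnion, not_exists] at hcon
  apply hx.2
  have hopen : IsOpen (⋂ i ∈ S, {x : V | ω x (u i) < t i}) :=
    isOpen_biInter_finset fun i _ => isOpen_lt (ch_cont hdim ω (u i)) continuous_const
  refine interior_maximal ?_ hopen ?_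
  · intro y hy i hi
    exact (Set.mem_iInter₂.1 hy i hi).le
  · refine Set.mem_iInter₂.2 fun i hi => ?_
    exact lt_of_le_of_ne (hx.1 i hi) fun he => hcon i hi ⟨hx.1, he⟩

/-- Sum of edge lengths is at most the perimeter. -/
lemma ch_perim (h : ChSetup ω u v S) (hb : Bornology.IsBounded (chPol ω u S t))
    (hdis : ∀ i ∈ S, ∀ j ∈ S, i ≠ j → (chEdge ω u S t i ∩ chEdge ω u S t j).Subsingleton) :
    ∑ i ∈ S, Metric.diam (chEdge ω u S t i) ≤ (μH[1] (frontier (chPol ω u S t))).toReal := by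
  have : NullSingletonClass (μH[1] : Measure V) :=
    Measure.nullSingletonClass_hausdorff V zero_lt_one
  have hsum : μH[1] (⋃ i ∈ S, chEdge ω u S t i) = ∑ i ∈ S, μH[1] (chEdge ω u S t i) := by
    apply measure_biUnion_finset₀
    · intro i hi j hj hij
      exact (hdis i hi j hj hij).measure_zero _
    · intro i _
      exact (ch_edge_compact h.dim hb i).isClosed.measurableSet.nullMeasurableSet
  have hsum2 : ∑ i ∈ S, μH[1] (chEdge ω u S t i) =
      ENNReal.ofReal (∑ i ∈ S, Metric.diam (chEdge ω u S t i)) := by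
    rw [ENNReal.ofReal_sum_of_nonneg fun _ _ => Metric.diam_nonneg]
    exact Finset.sum_congr rfl fun i hi => ch_edge_hausdorff h hb hi
  have hfin : μH[1] (frontier (chPol ω u S t)) ≠ ⊤ := by
    refine ne_top_of_le_ne_top ?_ (measure_mono (ch_frontier_sub h.dim))
    rw [hsum, hsum2]
    exact ENNReal.ofReal_ne_top
  rw [← ENNReal.ofReal_le_iff_le_toReal hfin, ← hsum2, ← hsum]
  exact measure_mono (Set.iUnion₂_subset fun i hi => ch_edge_frontier h hi)

end chak

/-- (Chakerian) Let the convex polygon `P` be the intersection of the half-planes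
`{x | f i x ≤ t i}`, let `D = {x | anorm ω (x - c) ≤ ρ}` be a largest anticircle contained
in `P`, and let `Q` be the polygon circumscribed about `D` whose sides are parallel to
those of `P`, i.e. `Q = {x | ∀ i, f i x ≤ sup (f i '' D)}`. Then
`area(P) + area(Q) ≤ ρ · L(∂P)`, where the perimeter of `P` in the norm is the
one-dimensional Hausdorff measure of its boundary. -/
theorem stmt17 {V : Type*} [NormedAddCommGroup V] [NormedSpace ℝ V]
    [MeasurableSpace V] [BorelSpace V]
    (hdim : Module.finrank ℝ V = 2)
    (ω : V →ₗ[ℝ] V →ₗ[ℝ] ℝ)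
    (halt : ∀ x : V, ω x x = 0)
    (hnd : ∀ a : V, (∀ y : V, ω a y = 0) → a = 0)
    (μ : Measure V) [μ.IsAddHaarMeasure]
    (hμω : ∀ x y : V,
      μ (Set.image2 (fun s t : ℝ => s • x + t • y) (Set.Icc 0 1) (Set.Icc 0 1)) =
        ENNReal.ofReal |ω x y|)
    (n : ℕ) (f : Fin n → (V →L[ℝ] ℝ)) (t : Fin n → ℝ) (hf : ∀ i, f i ≠ 0)
    (P : Set V) (hP : P = {x : V | ∀ i, f i x ≤ t i})
    (hPc : IsCompact P) (hPi : (interior P).Nonempty)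
    (ρ : ℝ) (hρ : 0 < ρ) (c : V)
    (D : Set V) (hD : D = {x : V | anorm ω (x - c) ≤ ρ})
    (hDP : D ⊆ P)
    (hmax : ∀ (ρ' : ℝ) (c' : V), 0 < ρ' → {x : V | anorm ω (x - c') ≤ ρ'} ⊆ P → ρ' ≤ ρ)
    (Q : Set V) (hQ : Q = {x : V | ∀ i, f i x ≤ sSup ((f i) '' D)}) :
    (μ P).toReal + (μ Q).toReal ≤ ρ * (μH[1] (frontier P)).toReal := by

  classical
  have hfd := ch_fd hdim
  have hW : ∀ i, ∃ w : V, w ≠ 0 ∧ ∀ x, f i x = ω x w := by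
    intro i
    obtain ⟨w, hw⟩ := ch_surj (ω := ω) hdim hnd (f i : V →ₗ[ℝ] ℝ)
    refine ⟨-w, ?_, fun x => ?_⟩
    · intro h0
      rw [neg_eq_zero] at h0
      apply hf i
      ext x
      have := hw x
      simpa [h0] using this
    · have := hw x
      rw [map_neg, ← ch_skew halt]
      exact this
  choose w hw0 hw using hW
  have hwn : ∀ i, 0 < ‖w i‖ := fun i => norm_pos_iff.2 (hw0 i)
  let e : Fin n → V × ℝ := fun i => (‖w i‖⁻¹ • w i, ‖w i‖⁻¹ * t i)
  let S : Finset (V × ℝ) := Finset.univ.image e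
  have hfe : ∀ i x, f i x = ‖w i‖ * ω x (e i).1 := by
    intro i x
    have := (hwn i).ne'
    simp only [e, map_smul, smul_eq_mul, hw]
    field_simp
  have hZ : ∀ p : V × ℝ, ∃ z : V, ‖p.1‖ = 1 → ω z p.1 = 1 ∧ ∀ y, ω z y ≤ ‖y‖ := by
    intro p
    by_cases hp : ‖p.1‖ = 1
    · obtain ⟨z, hz⟩ := ch_dual (ω := ω) hdim hnd hp
      exact ⟨z, fun _ => hz⟩
    · exact ⟨0, fun h => absurd h hp⟩
  choose v hv using hZ
  have hu : ∀ p ∈ S, ‖p.1‖ = 1 := by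
    intro p hp
    obtain ⟨i, -, rfl⟩ := Finset.mem_image.1 hp
    simp only [e, norm_smul, norm_inv, norm_norm]
    exact inv_mul_cancel₀ (hwn i).ne'
  have hset : ChSetup ω (Prod.fst : V × ℝ → V) v S :=
    ⟨hdim, halt, hnd, hu, fun p hp => (hv p (hu p hp)).1,
      fun p hp q hq => ((hv p (hu p hp)).2 q.1).trans (hu q hq).le⟩
  have hPS : P = chPol ω (Prod.fst : V × ℝ → V) S Prod.snd := by
    rw [hP]
    ext x
    simp only [chPol, Set.mem_ofPred_eq, S, Finset.forall_mem_image, Finset.mem_univ, true_imp_iff]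
    refine forall_congr' fun i => ?_
    rw [hfe]
    simp only [e]
    rw [le_inv_mul_iff₀ (hwn i)]
  have hb : Bornology.IsBounded (chPol ω (Prod.fst : V × ℝ → V) S Prod.snd) := by
    rw [← hPS]; exact hPc.isBounded
  have hcP : c ∈ chPol ω (Prod.fst : V × ℝ → V) S (fun i => i.2 - ρ) := by
    intro p hp
    have h1 : c + ρ • v p ∈ D := by
      rw [hD, Set.mem_ofPred_eq, ch_anorm hdim]
      intro y hy
      have := mul_le_mul_of_nonneg_left ((hv p (hu p hp)).2 y) hρ.le
      simp only [add_sub_cancel_left, map_smul, LinearMap.smul_apply, smul_eq_mul]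
      rw [hy, mul_one] at this
      exact this
    have h2 := hDP h1
    rw [hPS] at h2
    have h3 := h2 p hp
    simp only [map_add, map_smul, LinearMap.add_apply, LinearMap.smul_apply, smul_eq_mul,
      hset.hv1 p hp] at h3
    simp only
    linarith
  have hinter : interior (chPol ω (Prod.fst : V × ℝ → V) S (fun i => i.2 - ρ)) = ∅ := by
    rw [Set.eq_empty_iff_forall_notMem]
    intro x hx
    have h1 : ∀ᶠ ε : ℝ in nhdsWithin 0 (Set.Ioi 0), ∀ p ∈ S,
        x + ε • v p ∈ chPol ω (Prod.fst : V × ℝ → V) S (fun i => i.2 - ρ) :=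
      (Filter.eventually_all_finset S).2 fun p _ => ch_interior hx (v p)
    obtain ⟨ε, hε, hε0⟩ := (h1.and self_mem_nhdsWithin).exists
    have hε0 : (0 : ℝ) < ε := hε0
    have h2 := hmax (ρ + ε) x (by linarith) (by
      intro y hy
      rw [Set.mem_ofPred_eq, ch_anorm hdim] at hy
      rw [hPS]
      intro p hp
      have h3 := hε p hp p hp
      have h4 := hy p.1 (hu p hp)
      simp only [map_add, map_smul, map_sub, LinearMap.sub_apply, LinearMap.add_apply,
        LinearMap.smul_apply, smul_eq_mul, hset.hv1 p hp] at h3 h4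
      linarith)
    linarith
  have hzero : μ (chPol ω (Prod.fst : V × ℝ → V) S (fun i => i.2 - ρ)) = 0 := by
    have h1 := (ch_convex (ω := ω) (u := (Prod.fst : V × ℝ → V)) (J := S)
      (t := fun i => i.2 - ρ)).addHaar_frontier μ
    rwa [(ch_closed hdim).frontier_eq, hinter, Set.sdiff_empty] at h1
  have hmain := ch_main hset μ hμω hb hρ ⟨c, hcP⟩ hzero
  have hper := ch_perim hset hb (by
    intro p hp q hq hpq x hx y hy
    by_contra hxy
    have hx1 := hx.1.2
    have hx2 := hx.2.2
    have hy1 := hy.1.2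
    have hy2 := hy.2.2
    have hp0 : p.1 ≠ 0 := by intro h0; have := hu p hp; simp [h0] at this
    obtain ⟨a, ha⟩ := ch_ker (x := x - y) hdim halt hnd hp0 (by
      rw [map_sub, LinearMap.sub_apply, hx1, hy1, sub_self])
    have ha0 : a ≠ 0 := by
      rintro rfl
      rw [zero_smul] at ha
      exact hxy (sub_eq_zero.1 ha)
    have h1 : ω q.1 p.1 = 0 := by
      have : ω (x - y) q.1 = 0 := by
        rw [map_sub, LinearMap.sub_apply, hx2, hy2, sub_self]
      rw [ha, map_smul, LinearMap.smul_apply, smul_eq_mul] at this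
      rw [ch_skew halt, (mul_eq_zero.1 this).resolve_left ha0, neg_zero]
    obtain ⟨b, hbq⟩ := ch_ker hdim halt hnd hp0 h1
    have hb1 : |b| = 1 := by
      have := hu q hq
      rw [hbq, norm_smul, hu p hp, mul_one] at this
      exact this
    rcases eq_or_eq_neg_of_abs_eq hb1 with rfl | rfl
    · apply hpq
      rw [one_smul] at hbq
      refine Prod.ext hbq.symm ?_
      rw [← hx1, ← hx2, hbq]
    · have c1 := hcP p hp
      have c2 := hcP q hq
      simp only at c1 c2
      rw [← hx1] at c1
      rw [← hx2, hbq] at c2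
      simp only [map_smul, smul_eq_mul] at c2
      linarith)
  have hQsub : Q ⊆ (fun y => c + y) '' (ρ • chPol ω (Prod.fst : V × ℝ → V) S (fun _ => (1 : ℝ))) := by
    intro x hx
    refine ⟨x - c, ?_, by simp⟩
    rw [Set.mem_smul_set_iff_inv_smul_mem₀ hρ.ne']
    simp only [chPol, Set.mem_ofPred_eq, S, Finset.forall_mem_image, Finset.mem_univ, true_imp_iff]
    intro i
    rw [hQ] at hx
    have h1 : sSup ((f i) '' D) ≤ ‖w i‖ * (ω c (e i).1 + ρ) := by
      apply csSup_le
      · refine Set.Nonempty.image _ ⟨c, ?_⟩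
        rw [hD, Set.mem_ofPred_eq, ch_anorm hdim]
        intro y _
        simpa using hρ.le
      · rintro _ ⟨y, hy, rfl⟩
        rw [hD, Set.mem_ofPred_eq, ch_anorm hdim] at hy
        have h2 := hy (e i).1 (hu (e i) (Finset.mem_image_of_mem _ (Finset.mem_univ _)))
        rw [map_sub, LinearMap.sub_apply] at h2
        rw [hfe]
        apply mul_le_mul_of_nonneg_left _ (hwn i).le
        linarith
    have h3 := (hx i).trans h1
    rw [hfe] at h3
    have h4 := le_of_mul_le_mul_left h3 (hwn i)
    simp only [map_smul, map_sub, LinearMap.smul_apply, LinearMap.sub_apply, smul_eq_mul]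
    rw [inv_mul_le_iff₀ hρ]
    linarith
  have hQP : (fun y => c + y) '' (ρ • chPol ω (Prod.fst : V × ℝ → V) S (fun _ => (1 : ℝ))) ⊆
      chPol ω (Prod.fst : V × ℝ → V) S Prod.snd := by
    rintro _ ⟨_, ⟨y, hy, rfl⟩, rfl⟩ p hp
    have h1 := hcP p hp
    have h2 := mul_le_mul_of_nonneg_left (hy p hp) hρ.le
    simp only [map_add, map_smul, LinearMap.add_apply, LinearMap.smul_apply, smul_eq_mul] at *
    linarith
  have hQm : (μ Q).toReal ≤
      ρ ^ 2 * (μ (chPol ω (Prod.fst : V × ℝ → V) S (fun _ => (1 : ℝ)))).toReal := by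
    have h1 := ENNReal.toReal_mono (ch_bdd_meas hdim μ (hb.subset hQP)) (measure_mono hQsub)
    rwa [Set.image_add_left, measure_preimage_add, Measure.addHaar_smul, hdim, ENNReal.toReal_mul,
      ENNReal.toReal_ofReal (abs_nonneg _), abs_of_nonneg (sq_nonneg _)] at h1
  rw [hPS]
  have := mul_le_mul_of_nonneg_left hper hρ.le
  linarith
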